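/- NNF flat form with implications: any QCTL formula Φ is equivalent to a QCTL formula Ψ in negation normal form of the shape Q ∃{κ_1,…,κ_m}.( Φ_0 ∧ ⋀_{i=1..m} AG( κ_i → θ_i ) ), where Q is a sequence of propositional quantifications, Φ_0 is a CTL formula containing only the temporal modalities EX, AX and AG and of temporal height at most 1, and every θ_i is a basic CTL formula; moreover |Ψ| is in O(|Φ|). -/

import Mathlib

open Classical

/-- Syntax of QCTL: `φ ::= q | ¬φ | φ∨ψ | EX φ | E φ U ψ | A φ U ψ | ∃p.φ`. -/
inductive QCTL (AP : Type) : Type where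
  | atom : AP → QCTL AP
  | qneg : QCTL AP → QCTL AP
  | qor  : QCTL AP → QCTL AP → QCTL AP
  | qEX  : QCTL AP → QCTL AP
  | qEU  : QCTL AP → QCTL AP → QCTL AP
  | qAU  : QCTL AP → QCTL AP → QCTL AP
  | qexi : AP → QCTL AP → QCTL AP

/-- A Kripke structure over atomic propositions `AP` with (finite) state space `V`:
a serial edge relation and a labelling function. -/
structure Kripke (AP V : Type) where
  E : V → V → Prop
  serial : ∀ v, ∃ w, E v w
  label : V → Set AP

variable {AP V : Type}

/-- `K'` agrees with `K` (same edges) except possibly on the labelling of `p`. -/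
def Kripke.AgreeExcept (K K' : Kripke AP V) (p : AP) : Prop :=
  K'.E = K.E ∧ ∀ v q, q ≠ p → (q ∈ K'.label v ↔ q ∈ K.label v)

/-- Structure semantics of QCTL. -/
def QCTL.sat : QCTL AP → Kripke AP V → V → Prop
  | .atom p, K, x => p ∈ K.label x
  | .qneg φ, K, x => ¬ φ.sat K x
  | .qor φ ψ, K, x => φ.sat K x ∨ ψ.sat K x
  | .qEX φ, K, x => ∃ y, K.E x y ∧ φ.sat K y
  | .qEU φ ψ, K, x => ∃ ρ : ℕ → V, ρ 0 = x ∧ (∀ i, K.E (ρ i) (ρ (i + 1))) ∧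
      ∃ i, ψ.sat K (ρ i) ∧ ∀ j < i, φ.sat K (ρ j)
  | .qAU φ ψ, K, x => ∀ ρ : ℕ → V, ρ 0 = x → (∀ i, K.E (ρ i) (ρ (i + 1))) →
      ∃ i, ψ.sat K (ρ i) ∧ ∀ j < i, φ.sat K (ρ j)
  | .qexi p φ, K, x => ∃ K' : Kripke AP V, K.AgreeExcept K' p ∧ φ.sat K' x

namespace QCTL

def qand (φ ψ : QCTL AP) : QCTL AP := qneg (qor (qneg φ) (qneg ψ))
def qimp (φ ψ : QCTL AP) : QCTL AP := qor (qneg φ) ψ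
def qiff (φ ψ : QCTL AP) : QCTL AP := qand (qimp φ ψ) (qimp ψ φ)
def qtop [Inhabited AP] : QCTL AP := qor (atom default) (qneg (atom default))
def qbot [Inhabited AP] : QCTL AP := qneg qtop
def qAX (φ : QCTL AP) : QCTL AP := qneg (qEX (qneg φ))
def qEF [Inhabited AP] (φ : QCTL AP) : QCTL AP := qEU qtop φ
def qAG [Inhabited AP] (φ : QCTL AP) : QCTL AP := qneg (qEF (qneg φ))
def qall (p : AP) (φ : QCTL AP) : QCTL AP := qneg (qexi p (qneg φ))

/-- All atomic propositions occurring in a formula (free or bound). -/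
def atoms : QCTL AP → Set AP
  | atom p => {p}
  | qneg φ => φ.atoms
  | qor φ ψ => φ.atoms ∪ ψ.atoms
  | qEX φ => φ.atoms
  | qEU φ ψ => φ.atoms ∪ ψ.atoms
  | qAU φ ψ => φ.atoms ∪ ψ.atoms
  | qexi p φ => insert p φ.atoms

/-- Size of a formula. -/
def qsize : QCTL AP → ℕ
  | atom _ => 1
  | qneg φ => φ.qsize + 1
  | qor φ ψ => φ.qsize + ψ.qsize + 1
  | qEX φ => φ.qsize + 1
  | qEU φ ψ => φ.qsize + ψ.qsize + 1
  | qAU φ ψ => φ.qsize + ψ.qsize + 1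
  | qexi _ φ => φ.qsize + 1

end QCTL

/-- Equivalence of two QCTL formulas: same truth value at every state of every
(finite) Kripke structure. -/
def QEquiv (φ ψ : QCTL AP) : Prop :=
  ∀ (V : Type) [Fintype V] (K : Kripke AP V) (x : V), φ.sat K x ↔ ψ.sat K x

/-- Negation normal form QCTL formulas: negation is applied only to atomic
propositions; formulas are built from literals, `∧`, `∨`, the modalities
`EX`, `AX`, `EU`, `AU`, `EW`, `AW` (and the derived modality `AG`, kept primitive),
and propositional quantifiers. -/
inductive NNF (AP : Type) : Type where
  | atom : AP → NNF AP
  | natom : AP → NNF AP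
  | nand : NNF AP → NNF AP → NNF AP
  | nor : NNF AP → NNF AP → NNF AP
  | nEX : NNF AP → NNF AP
  | nAX : NNF AP → NNF AP
  | nEU : NNF AP → NNF AP → NNF AP
  | nAU : NNF AP → NNF AP → NNF AP
  | nEW : NNF AP → NNF AP → NNF AP
  | nAW : NNF AP → NNF AP → NNF AP
  | nAG : NNF AP → NNF AP
  | nexi : AP → NNF AP → NNF AP
  | nall : AP → NNF AP → NNF AP

namespace NNF
variable {AP : Type}

/-- Reading of an NNF formula as a plain QCTL formula, using the abbreviations
`AX φ := ¬EX¬φ`, `E φ W ψ := ¬A(¬ψ)U(¬ψ∧¬φ)`, `A φ W ψ := ¬E(¬ψ)U(¬ψ∧¬φ)`,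
`AG φ := ¬E⊤U¬φ` and `∀p.φ := ¬∃p.¬φ`. -/
def toQCTL [Inhabited AP] : NNF AP → QCTL AP
  | atom p => QCTL.atom p
  | natom p => QCTL.qneg (QCTL.atom p)
  | nand φ ψ => QCTL.qand φ.toQCTL ψ.toQCTL
  | nor φ ψ => QCTL.qor φ.toQCTL ψ.toQCTL
  | nEX φ => QCTL.qEX φ.toQCTL
  | nAX φ => QCTL.qAX φ.toQCTL
  | nEU φ ψ => QCTL.qEU φ.toQCTL ψ.toQCTL
  | nAU φ ψ => QCTL.qAU φ.toQCTL ψ.toQCTL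
  | nEW φ ψ =>
      QCTL.qneg (QCTL.qAU (QCTL.qneg ψ.toQCTL)
        (QCTL.qand (QCTL.qneg ψ.toQCTL) (QCTL.qneg φ.toQCTL)))
  | nAW φ ψ =>
      QCTL.qneg (QCTL.qEU (QCTL.qneg ψ.toQCTL)
        (QCTL.qand (QCTL.qneg ψ.toQCTL) (QCTL.qneg φ.toQCTL)))
  | nAG φ => QCTL.qAG φ.toQCTL
  | nexi p φ => QCTL.qexi p φ.toQCTL
  | nall p φ => QCTL.qall p φ.toQCTL

/-- Size of an NNF formula. -/
def nsize : NNF AP → ℕ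
  | atom _ => 1
  | natom _ => 2
  | nand φ ψ => φ.nsize + ψ.nsize + 1
  | nor φ ψ => φ.nsize + ψ.nsize + 1
  | nEX φ => φ.nsize + 1
  | nAX φ => φ.nsize + 1
  | nEU φ ψ => φ.nsize + ψ.nsize + 1
  | nAU φ ψ => φ.nsize + ψ.nsize + 1
  | nEW φ ψ => φ.nsize + ψ.nsize + 1
  | nAW φ ψ => φ.nsize + ψ.nsize + 1
  | nAG φ => φ.nsize + 1
  | nexi _ φ => φ.nsize + 1
  | nall _ φ => φ.nsize + 1

/-- Temporal height of an NNF formula. -/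
def nht : NNF AP → ℕ
  | atom _ => 0
  | natom _ => 0
  | nand φ ψ => max φ.nht ψ.nht
  | nor φ ψ => max φ.nht ψ.nht
  | nEX φ => φ.nht + 1
  | nAX φ => φ.nht + 1
  | nEU φ ψ => max φ.nht ψ.nht + 1
  | nAU φ ψ => max φ.nht ψ.nht + 1
  | nEW φ ψ => max φ.nht ψ.nht + 1
  | nAW φ ψ => max φ.nht ψ.nht + 1
  | nAG φ => φ.nht + 1
  | nexi _ φ => φ.nht
  | nall _ φ => φ.nht

/-- `∃p₁.…∃pₙ.φ` in NNF. -/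
def exiMany (l : List AP) (φ : NNF AP) : NNF AP := l.foldr nexi φ

/-- A sequence of propositional quantifications (`true` = `∃`, `false` = `∀`). -/
def prefixQ (Q : List (Bool × AP)) (φ : NNF AP) : NNF AP :=
  Q.foldr (fun bp acc => if bp.1 then nexi bp.2 acc else nall bp.2 acc) φ

end NNF

/-- Boolean combinations of atomic propositions, in NNF. -/
inductive NNFBoolAtoms {AP : Type} : NNF AP → Prop where
  | atom (p : AP) : NNFBoolAtoms (NNF.atom p)
  | natom (p : AP) : NNFBoolAtoms (NNF.natom p)
  | nand {φ ψ} : NNFBoolAtoms φ → NNFBoolAtoms ψ → NNFBoolAtoms (NNF.nand φ ψ)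
  | nor {φ ψ} : NNFBoolAtoms φ → NNFBoolAtoms ψ → NNFBoolAtoms (NNF.nor φ ψ)

/-- Basic CTL formulas in NNF: a single modality among `EX`, `AX`, `EU`, `AU`, `EW`,
`AW` applied to Boolean combinations of atomic propositions. -/
inductive NNFBasic {AP : Type} : NNF AP → Prop where
  | nEX {α} : NNFBoolAtoms α → NNFBasic (NNF.nEX α)
  | nAX {α} : NNFBoolAtoms α → NNFBasic (NNF.nAX α)
  | nEU {α β} : NNFBoolAtoms α → NNFBoolAtoms β → NNFBasic (NNF.nEU α β)
  | nAU {α β} : NNFBoolAtoms α → NNFBoolAtoms β → NNFBasic (NNF.nAU α β)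
  | nEW {α β} : NNFBoolAtoms α → NNFBoolAtoms β → NNFBasic (NNF.nEW α β)
  | nAW {α β} : NNFBoolAtoms α → NNFBoolAtoms β → NNFBasic (NNF.nAW α β)

/-- Quantifier-free NNF formulas containing only the temporal modalities
`EX`, `AX` and `AG`. -/
inductive NNFOnlyEXAXAG {AP : Type} : NNF AP → Prop where
  | atom (p : AP) : NNFOnlyEXAXAG (NNF.atom p)
  | natom (p : AP) : NNFOnlyEXAXAG (NNF.natom p)
  | nand {φ ψ} : NNFOnlyEXAXAG φ → NNFOnlyEXAXAG ψ → NNFOnlyEXAXAG (NNF.nand φ ψ)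
  | nor {φ ψ} : NNFOnlyEXAXAG φ → NNFOnlyEXAXAG ψ → NNFOnlyEXAXAG (NNF.nor φ ψ)
  | nEX {φ} : NNFOnlyEXAXAG φ → NNFOnlyEXAXAG (NNF.nEX φ)
  | nAX {φ} : NNFOnlyEXAXAG φ → NNFOnlyEXAXAG (NNF.nAX φ)
  | nAG {φ} : NNFOnlyEXAXAG φ → NNFOnlyEXAXAG (NNF.nAG φ)

/-- The NNF body `Φ₀ ∧ ⋀_{i=1..m} AG( κᵢ → θᵢ )` (with `κᵢ → θᵢ` written `¬κᵢ ∨ θᵢ`). -/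
def nnfFlatBody {AP : Type} (m : ℕ) (κ : Fin m → AP)
    (Φ0 : NNF AP) (θ : Fin m → NNF AP) : NNF AP :=
  ((List.finRange m).map fun i => NNF.nAG (NNF.nor (NNF.natom (κ i)) (θ i))).foldr
    NNF.nand Φ0

namespace QCTL

variable {AP V : Type}

/-- The labelling `L` with the `p`-labelled states replaced by `s`. -/
def setAtom (L : V → Set AP) (p : AP) (s : Set V) : V → Set AP :=
  fun v => {q | if q = p then v ∈ s else q ∈ L v}

@[simp] theorem mem_setAtom (L : V → Set AP) (p q : AP) (s : Set V) (v : V) :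
    q ∈ setAtom L p s v ↔ if q = p then v ∈ s else q ∈ L v := Iff.rfl

theorem sat_qexi_iff (p : AP) (φ : QCTL AP) (E : V → V → Prop) (h : ∀ v, ∃ w, E v w)
    (L : V → Set AP) (x : V) :
    (qexi p φ).sat ⟨E, h, L⟩ x ↔ ∃ s : Set V, φ.sat ⟨E, h, setAtom L p s⟩ x := by
  constructor
  · rintro ⟨⟨E', h', L'⟩, ⟨hE, hL⟩, hφ⟩
    obtain rfl : E' = E := hE
    refine ⟨{v | p ∈ L' v}, ?_⟩
    have : setAtom L p {v | p ∈ L' v} = L' := by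
      funext v
      ext q
      by_cases hq : q = p
      · simp [hq]
      · simpa [hq] using (hL v q hq).symm
    rwa [this]
  · rintro ⟨s, hs⟩
    exact ⟨⟨E, h, setAtom L p s⟩, ⟨rfl, fun v q hq => by simp [hq]⟩, hs⟩

/-- Satisfaction depends only on the labelling of the atoms of the formula. -/
theorem sat_congr (E : V → V → Prop) (h : ∀ v, ∃ w, E v w) (φ : QCTL AP) :
    ∀ (L L' : V → Set AP), (∀ a ∈ φ.atoms, ∀ v, a ∈ L' v ↔ a ∈ L v) →
      ∀ x, φ.sat ⟨E, h, L'⟩ x ↔ φ.sat ⟨E, h, L⟩ x := by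
  induction φ with
  | atom p => intro L L' hL x; exact hL p rfl x
  | qneg φ ih => intro L L' hL x; exact not_congr (ih L L' hL x)
  | qor φ ψ ih₁ ih₂ =>
    intro L L' hL x
    exact or_congr (ih₁ L L' (fun a ha => hL a (Or.inl ha)) x)
      (ih₂ L L' (fun a ha => hL a (Or.inr ha)) x)
  | qEX φ ih => intro L L' hL x; simp only [sat, ih L L' hL]
  | qEU φ ψ ih₁ ih₂ =>
    intro L L' hL x
    simp only [sat, ih₁ L L' (fun a ha => hL a (Or.inl ha)),
      ih₂ L L' (fun a ha => hL a (Or.inr ha))]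
  | qAU φ ψ ih₁ ih₂ =>
    intro L L' hL x
    simp only [sat, ih₁ L L' (fun a ha => hL a (Or.inl ha)),
      ih₂ L L' (fun a ha => hL a (Or.inr ha))]
  | qexi p φ ih =>
    intro L L' hL x
    simp only [sat_qexi_iff]
    refine exists_congr fun s => ih _ _ (fun a ha v => ?_) x
    by_cases hp : a = p
    · simp [hp]
    · simpa [hp] using hL a (Or.inr ha) v

theorem atoms_finite (φ : QCTL AP) : φ.atoms.Finite := by
  induction φ with
  | atom p => exact Set.finite_singleton p
  | qneg φ ih => exact ih
  | qor φ ψ ih₁ ih₂ => exact ih₁.union ih₂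
  | qEX φ ih => exact ih
  | qEU φ ψ ih₁ ih₂ => exact ih₁.union ih₂
  | qAU φ ψ ih₁ ih₂ => exact ih₁.union ih₂
  | qexi p φ ih => exact ih.insert p

theorem qsize_pos (φ : QCTL AP) : 0 < φ.qsize := by
  cases φ <;> simp [qsize]

end QCTL

section Paths

variable {V : Type}

/-- `B` holds at some point of the sequence `ρ`, and `A` at all earlier points. -/
def PathUntil (A B : V → Prop) (ρ : ℕ → V) : Prop :=
  ∃ i, B (ρ i) ∧ ∀ j < i, A (ρ j)

/-- Existential until over the edge relation `E`. -/
def ExistsUntil (E : V → V → Prop) (A B : V → Prop) (x : V) : Prop :=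
  ∃ ρ : ℕ → V, ρ 0 = x ∧ (∀ i, E (ρ i) (ρ (i + 1))) ∧ PathUntil A B ρ

/-- Universal until over the edge relation `E`. -/
def ForallUntil (E : V → V → Prop) (A B : V → Prop) (x : V) : Prop :=
  ∀ ρ : ℕ → V, ρ 0 = x → (∀ i, E (ρ i) (ρ (i + 1))) → PathUntil A B ρ

theorem reach_of_path {E : V → V → Prop} {ρ : ℕ → V} {x : V} (h0 : ρ 0 = x)
    (hρ : ∀ i, E (ρ i) (ρ (i + 1))) (i : ℕ) : Relation.ReflTransGen E x (ρ i) := by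
  induction i with
  | zero => rw [h0]
  | succ i ih => exact ih.tail (hρ i)

theorem exists_path {E : V → V → Prop} (h : ∀ v, ∃ w, E v w) (x : V) :
    ∃ ρ : ℕ → V, ρ 0 = x ∧ ∀ i, E (ρ i) (ρ (i + 1)) := by
  choose f hf using h
  exact ⟨fun i => f^[i] x, rfl, fun i => by
    simpa only [Function.iterate_succ_apply'] using hf _⟩

theorem exists_path_through {E : V → V → Prop} (h : ∀ v, ∃ w, E v w) {x y : V}
    (hxy : Relation.ReflTransGen E x y) :
    ∃ ρ : ℕ → V, ρ 0 = x ∧ (∀ i, E (ρ i) (ρ (i + 1))) ∧ ∃ i, ρ i = y := by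
  induction hxy using Relation.ReflTransGen.head_induction_on with
  | refl =>
    obtain ⟨ρ, h0, hρ⟩ := exists_path h y
    exact ⟨ρ, h0, hρ, 0, h0⟩
  | @head a c hac _ ih =>
    obtain ⟨ρ, h0, hρ, i, hi⟩ := ih
    refine ⟨fun k => Nat.casesOn k a ρ, rfl, fun k => ?_, i + 1, hi⟩
    cases k with
    | zero => simpa [h0] using hac
    | succ k => exact hρ k

theorem existsUntil_of_forall {E : V → V → Prop} (h : ∀ v, ∃ w, E v w) {A B : V → Prop}
    (hA : ∀ v, A v) (x : V) :
    ExistsUntil E A B x ↔ ∃ y, Relation.ReflTransGen E x y ∧ B y := by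
  constructor
  · rintro ⟨ρ, h0, hρ, i, hB, -⟩
    exact ⟨ρ i, reach_of_path h0 hρ i, hB⟩
  · rintro ⟨y, hxy, hB⟩
    obtain ⟨ρ, h0, hρ, i, rfl⟩ := exists_path_through h hxy
    exact ⟨ρ, h0, hρ, i, hB, fun j _ => hA _⟩

theorem existsUntil_self {E : V → V → Prop} (h : ∀ v, ∃ w, E v w) (A : V → Prop) (x : V) :
    ExistsUntil E A A x ↔ A x := by
  constructor
  · rintro ⟨ρ, rfl, -, i, hi, hj⟩
    rcases Nat.eq_zero_or_pos i with rfl | hpos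
    · exact hi
    · exact hj 0 hpos
  · intro hA
    obtain ⟨ρ, rfl, hρ⟩ := exists_path h x
    exact ⟨ρ, rfl, hρ, 0, hA, by simp⟩

theorem pathUntil_mono {E : V → V → Prop} {A A' B B' : V → Prop} {ρ : ℕ → V} {x : V}
    (h0 : ρ 0 = x) (hρ : ∀ i, E (ρ i) (ρ (i + 1)))
    (hA : ∀ v, Relation.ReflTransGen E x v → A v → A' v)
    (hB : ∀ v, Relation.ReflTransGen E x v → B v → B' v) (hU : PathUntil A B ρ) :
    PathUntil A' B' ρ := by
  obtain ⟨i, hi, hj⟩ := hU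
  exact ⟨i, hB _ (reach_of_path h0 hρ i) hi,
    fun j hji => hA _ (reach_of_path h0 hρ j) (hj j hji)⟩

theorem existsUntil_mono {E : V → V → Prop} {A A' B B' : V → Prop} {x : V}
    (hA : ∀ v, Relation.ReflTransGen E x v → A v → A' v)
    (hB : ∀ v, Relation.ReflTransGen E x v → B v → B' v) (hU : ExistsUntil E A B x) :
    ExistsUntil E A' B' x := by
  obtain ⟨ρ, h0, hρ, hU⟩ := hU
  exact ⟨ρ, h0, hρ, pathUntil_mono h0 hρ hA hB hU⟩

theorem forallUntil_mono {E : V → V → Prop} {A A' B B' : V → Prop} {x : V}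
    (hA : ∀ v, Relation.ReflTransGen E x v → A v → A' v)
    (hB : ∀ v, Relation.ReflTransGen E x v → B v → B' v) (hU : ForallUntil E A B x) :
    ForallUntil E A' B' x :=
  fun ρ h0 hρ => pathUntil_mono h0 hρ hA hB (hU ρ h0 hρ)

theorem pathUntil_not_iff (A B : V → Prop) (ρ : ℕ → V) :
    PathUntil (fun v => ¬(A v ∧ B v)) (fun v => ¬(A v ∧ B v) ∧ ¬B v) ρ ↔
      PathUntil (fun v => ¬A v) (fun v => ¬B v) ρ := by
  constructor
  · rintro ⟨i, ⟨-, hi⟩, hj⟩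
    have hex : ∃ i, ¬B (ρ i) := ⟨i, hi⟩
    refine ⟨Nat.find hex, Nat.find_spec hex, fun j hj' hA => ?_⟩
    exact hj j (hj'.trans_le (Nat.find_min' hex hi)) ⟨hA, not_not.1 (Nat.find_min hex hj')⟩
  · rintro ⟨i, hi, hj⟩
    exact ⟨i, ⟨fun hAB => hi hAB.2, hi⟩, fun j hji hAB => hj j hji hAB.1⟩

end Paths

namespace QCTL

variable {AP V : Type}

theorem sat_qEU_iff (φ ψ : QCTL AP) (K : Kripke AP V) (x : V) :
    (qEU φ ψ).sat K x ↔ ExistsUntil K.E (φ.sat K) (ψ.sat K) x := Iff.rfl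

theorem sat_qAU_iff (φ ψ : QCTL AP) (K : Kripke AP V) (x : V) :
    (qAU φ ψ).sat K x ↔ ForallUntil K.E (φ.sat K) (ψ.sat K) x := Iff.rfl

theorem sat_qneg_iff (φ : QCTL AP) (K : Kripke AP V) (x : V) :
    (qneg φ).sat K x ↔ ¬φ.sat K x := Iff.rfl

theorem sat_qand_iff (φ ψ : QCTL AP) (K : Kripke AP V) (x : V) :
    (qand φ ψ).sat K x ↔ φ.sat K x ∧ ψ.sat K x := by
  simp only [qand, sat]
  tauto

theorem sat_qAG_iff [Inhabited AP] (φ : QCTL AP) (K : Kripke AP V) (x : V) :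
    (qAG φ).sat K x ↔ ∀ y, Relation.ReflTransGen K.E x y → φ.sat K y := by
  rw [qAG, sat_qneg_iff, qEF, sat_qEU_iff,
    existsUntil_of_forall K.serial (fun v => by simp only [qtop, sat]; tauto)]
  simp only [sat, not_exists, not_and, not_not]

end QCTL

section Game

variable {AP V : Type}

open QCTL

/-- The quantifier prefix `Q` evaluated from the labelling `L` with matrix `T`. -/
def play : List (Bool × AP) → (V → Set AP) → ((V → Set AP) → Prop) → Prop
  | [], L, T => T L
  | (true, p) :: Q, L, T => ∃ s : Set V, play Q (setAtom L p s) T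
  | (false, p) :: Q, L, T => ∀ s : Set V, play Q (setAtom L p s) T

/-- The quantifier prefix with every quantifier dualized. -/
def dualPrefix (Q : List (Bool × AP)) : List (Bool × AP) := Q.map fun q => (!q.1, q.2)

theorem play_append (Q Q' : List (Bool × AP)) (L : V → Set AP) (T : (V → Set AP) → Prop) :
    play (Q ++ Q') L T ↔ play Q L fun L' => play Q' L' T := by
  induction Q generalizing L with
  | nil => rfl
  | cons q Q ih =>
    obtain ⟨_ | _, p⟩ := q
    · exact forall_congr' fun s => ih _
    · exact exists_congr fun s => ih _

/-- `L'` and `L` coincide on the atoms of level less than `n`. -/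
def AgreeBelow (lev : AP → ℕ) (n : ℕ) (L L' : V → Set AP) : Prop :=
  ∀ a, lev a < n → ∀ v, a ∈ L' v ↔ a ∈ L v

theorem AgreeBelow.trans {lev : AP → ℕ} {n : ℕ} {L L' L'' : V → Set AP}
    (h : AgreeBelow lev n L L') (h' : AgreeBelow lev n L' L'') : AgreeBelow lev n L L'' :=
  fun a ha v => (h' a ha v).trans (h a ha v)

theorem AgreeBelow.mono {lev : AP → ℕ} {n m : ℕ} {L L' : V → Set AP}
    (h : AgreeBelow lev n L L') (hm : m ≤ n) : AgreeBelow lev m L L' :=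
  fun a ha v => h a (ha.trans_le hm) v

theorem agreeBelow_setAtom {lev : AP → ℕ} {n : ℕ} {p : AP} (hp : n ≤ lev p)
    (L : V → Set AP) (s : Set V) : AgreeBelow lev n L (setAtom L p s) := by
  intro a ha v
  have : a ≠ p := by rintro rfl; omega
  simp [this]

theorem play_mono {lev : AP → ℕ} {n : ℕ} {Q : List (Bool × AP)}
    (hQ : ∀ q ∈ Q, n ≤ lev q.2) {L : V → Set AP} {T T' : (V → Set AP) → Prop}
    (h : play Q L T) (hT : ∀ L', AgreeBelow lev n L L' → T L' → T' L') : play Q L T' := by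
  induction Q generalizing L with
  | nil => exact hT L (fun _ _ _ => Iff.rfl) h
  | cons q Q ih =>
    have hp := hQ q List.mem_cons_self
    have hQ' : ∀ q ∈ Q, n ≤ lev q.2 := fun q hq => hQ q (List.mem_cons_of_mem _ hq)
    obtain ⟨_ | _, p⟩ := q
    · exact fun s => ih hQ' (h s) fun L' hL' => hT L' ((agreeBelow_setAtom hp L s).trans hL')
    · obtain ⟨s, hs⟩ := h
      exact ⟨s, ih hQ' hs fun L' hL' => hT L' ((agreeBelow_setAtom hp L s).trans hL')⟩

theorem play_of_forall (Q : List (Bool × AP)) (L : V → Set AP) {T : (V → Set AP) → Prop}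
    (hT : ∀ L', T L') : play Q L T := by
  induction Q generalizing L with
  | nil => exact hT L
  | cons q Q ih =>
    obtain ⟨_ | _, p⟩ := q
    · exact fun s => ih _
    · exact ⟨∅, ih _⟩

/-- Two opposing strategies meet in a common final labelling. -/
theorem exists_of_play_dual {Q : List (Bool × AP)} {L : V → Set AP}
    {T T' : (V → Set AP) → Prop} (h : play Q L T) (h' : play (dualPrefix Q) L T') :
    ∃ L', T L' ∧ T' L' := by
  induction Q generalizing L with
  | nil => exact ⟨L, h, h'⟩
  | cons q Q ih =>
    obtain ⟨_ | _, p⟩ := q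
    · obtain ⟨s, hs⟩ := h'
      exact ih (h s) hs
    · obtain ⟨s, hs⟩ := h
      exact ih hs (h' s)

theorem play_exists_iff (l : List AP) (L : V → Set AP) (T : (V → Set AP) → Prop) :
    play (l.map (Prod.mk true)) L T ↔
      ∃ L', (∀ a ∉ l, ∀ v, a ∈ L' v ↔ a ∈ L v) ∧ T L' := by
  induction l generalizing L with
  | nil =>
    constructor
    · exact fun h => ⟨L, fun _ _ _ => Iff.rfl, h⟩
    · rintro ⟨L', hL, hT⟩
      obtain rfl : L' = L := by
        funext v
        ext a
        exact hL a (by simp) v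
      exact hT
  | cons p l ih =>
    simp only [List.map_cons, play, ih]
    constructor
    · rintro ⟨s, L', hL, hT⟩
      refine ⟨L', fun a ha v => ?_, hT⟩
      simp only [List.mem_cons, not_or] at ha
      simpa [ha.1] using hL a ha.2 v
    · rintro ⟨L', hL, hT⟩
      refine ⟨{v | p ∈ L' v}, L', fun a ha v => ?_, hT⟩
      by_cases hp : a = p
      · simp [hp]
      · simpa [hp] using hL a (by simp [hp, ha]) v

theorem sat_prefixQ_iff [Inhabited AP] (E : V → V → Prop) (h : ∀ v, ∃ w, E v w)
    (Q : List (Bool × AP)) (φ : NNF AP) (L : V → Set AP) (x : V) :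
    (NNF.prefixQ Q φ).toQCTL.sat ⟨E, h, L⟩ x ↔
      play Q L fun L' => φ.toQCTL.sat ⟨E, h, L'⟩ x := by
  induction Q generalizing L with
  | nil => rfl
  | cons q Q ih =>
    obtain ⟨_ | _, p⟩ := q
    · change ¬(qexi p (qneg (NNF.prefixQ Q φ).toQCTL)).sat ⟨E, h, L⟩ x ↔ _
      rw [sat_qexi_iff]
      simp only [sat_qneg_iff, not_exists, not_not, ih, play]
    · change (qexi p (NNF.prefixQ Q φ).toQCTL).sat ⟨E, h, L⟩ x ↔ _
      simp only [sat_qexi_iff, ih, play]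

theorem exiMany_eq_prefixQ (l : List AP) (φ : NNF AP) :
    NNF.exiMany l φ = NNF.prefixQ (l.map (Prod.mk true)) φ := by
  induction l with
  | nil => rfl
  | cons p l ih => simpa [NNF.exiMany, NNF.prefixQ] using ih

theorem nsize_prefixQ (Q : List (Bool × AP)) (φ : NNF AP) :
    (NNF.prefixQ Q φ).nsize = Q.length + φ.nsize := by
  induction Q with
  | nil => simp [NNF.prefixQ]
  | cons q Q ih =>
    obtain ⟨_ | _, p⟩ := q <;>
      · simp only [NNF.prefixQ, List.foldr_cons, List.length_cons] at ih ⊢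
        simp [NNF.nsize, ih]
        omega

end Game

section Conjunctions

variable {AP V : Type}

theorem sat_foldr_nand_iff [Inhabited AP] (K : Kripke AP V) (x : V) (φ : NNF AP)
    (l : List (NNF AP)) :
    (l.foldr NNF.nand φ).toQCTL.sat K x ↔
      φ.toQCTL.sat K x ∧ ∀ ψ ∈ l, ψ.toQCTL.sat K x := by
  induction l with
  | nil => simp
  | cons ψ l ih =>
    simp only [List.foldr_cons, NNF.toQCTL, QCTL.sat_qand_iff, ih, List.mem_cons,
      forall_eq_or_imp]
    tauto

theorem nsize_foldr_nand (φ : NNF AP) (l : List (NNF AP)) {k : ℕ}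
    (hl : ∀ ψ ∈ l, ψ.nsize ≤ k) :
    (l.foldr NNF.nand φ).nsize ≤ φ.nsize + l.length * (k + 1) := by
  induction l with
  | nil => simp
  | cons ψ l ih =>
    have h₁ := hl ψ List.mem_cons_self
    have h₂ := ih fun χ hχ => hl χ (List.mem_cons_of_mem _ hχ)
    simp only [List.foldr_cons, NNF.nsize, List.length_cons, Nat.succ_mul]
    omega

end Conjunctions

section Representation

variable {AP : Type}

open QCTL

/-- State predicates, uniform in the underlying transition system and labelling. -/
abbrev StatePred (AP : Type) : Type 1 :=
  ∀ (V : Type) (E : V → V → Prop), (∀ v, ∃ w, E v w) → (V → Set AP) → V → Prop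

/-- The predicate only depends on atoms of level less than `n`. -/
def StatePred.DependsBelow (P : StatePred AP) (lev : AP → ℕ) (n : ℕ) : Prop :=
  ∀ (V : Type) (E : V → V → Prop) (h : ∀ v, ∃ w, E v w) (L L' : V → Set AP),
    AgreeBelow lev n L L' → ∀ v, P V E h L' v ↔ P V E h L v

/-- The atoms of `φ` have level less than `n`. -/
def NNF.AtomsBelow [Inhabited AP] (lev : AP → ℕ) (n : ℕ) (φ : NNF AP) : Prop :=
  ∀ a ∈ φ.toQCTL.atoms, lev a < n

/-- The conjunction at `x` of the formulas `AG (k → θ)` for `(k, θ)` in `B` and of those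
in `R`. -/
def Constraints [Inhabited AP] {V : Type} (B : List (AP × NNF AP)) (R : List (NNF AP))
    (E : V → V → Prop) (h : ∀ v, ∃ w, E v w) (x : V) (L : V → Set AP) : Prop :=
  (∀ p ∈ B, ∀ v, Relation.ReflTransGen E x v → p.1 ∈ L v → p.2.toQCTL.sat ⟨E, h, L⟩ v) ∧
    ∀ r ∈ R, r.toQCTL.sat ⟨E, h, L⟩ x

/-- The well-formedness of constraints using atoms of level less than `n`. -/
structure ConstraintsWF [Inhabited AP] (lev : AP → ℕ) (n : ℕ) (B : List (AP × NNF AP))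
    (R : List (NNF AP)) : Prop where
  key : ∀ p ∈ B, lev p.1 < n
  atomsB : ∀ p ∈ B, p.2.AtomsBelow lev n
  basic : ∀ p ∈ B, NNFBasic p.2
  sizeB : ∀ p ∈ B, p.2.nsize ≤ 20
  atomsR : ∀ r ∈ R, r.AtomsBelow lev n
  only : ∀ r ∈ R, NNFOnlyEXAXAG r
  height : ∀ r ∈ R, r.nht ≤ 1
  sizeR : ∀ r ∈ R, r.nsize ≤ 20

/-- The atom `c`, subject to the quantifier prefix `Q` and the constraints `B`, `R`,
represents the state predicate `P`. The quantified atoms have levels in `[n, n')`. -/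
structure Represents [Inhabited AP] (lev : AP → ℕ) (n n' : ℕ) (Q : List (Bool × AP))
    (B : List (AP × NNF AP)) (R : List (NNF AP)) (c : AP) (P : StatePred AP) : Prop where
  le : n ≤ n'
  low : ∀ q ∈ Q, n ≤ lev q.2
  wf : ConstraintsWF lev n' B R
  head : lev c < n'
  upper : ∀ (V : Type) (E : V → V → Prop) (h : ∀ v, ∃ w, E v w) (L : V → Set AP) (x : V),
    play Q L fun L' => Constraints B R E h x L' ∧
      ∀ v, Relation.ReflTransGen E x v → P V E h L v → c ∈ L' v
  lower : ∀ (V : Type) (E : V → V → Prop) (h : ∀ v, ∃ w, E v w) (L : V → Set AP) (x : V),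
    play (dualPrefix Q) L fun L' => Constraints B R E h x L' →
      ∀ v, Relation.ReflTransGen E x v → c ∈ L' v → P V E h L v

theorem le_of_mem_dualPrefix {lev : AP → ℕ} {n : ℕ} {Q : List (Bool × AP)}
    (hQ : ∀ q ∈ Q, n ≤ lev q.2) : ∀ q ∈ dualPrefix Q, n ≤ lev q.2 := by
  intro q hq
  obtain ⟨q', hq', rfl⟩ := List.mem_map.1 hq
  exact hQ q' hq'

variable [Inhabited AP]

theorem NNF.AtomsBelow.mono {lev : AP → ℕ} {n m : ℕ} {φ : NNF AP}
    (h : φ.AtomsBelow lev n) (hm : n ≤ m) : φ.AtomsBelow lev m :=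
  fun a ha => (h a ha).trans_le hm

theorem NNF.AtomsBelow.sat_iff {V : Type} {lev : AP → ℕ} {n : ℕ} {φ : NNF AP}
    (hφ : φ.AtomsBelow lev n) {E : V → V → Prop} (h : ∀ v, ∃ w, E v w) {L L' : V → Set AP}
    (hL : AgreeBelow lev n L L') (x : V) :
    φ.toQCTL.sat ⟨E, h, L'⟩ x ↔ φ.toQCTL.sat ⟨E, h, L⟩ x :=
  sat_congr E h _ L L' (fun a ha v => hL a (hφ a ha) v) x

theorem constraints_congr {V : Type} {lev : AP → ℕ} {n : ℕ} {B : List (AP × NNF AP)}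
    {R : List (NNF AP)} (wf : ConstraintsWF lev n B R) {E : V → V → Prop}
    (h : ∀ v, ∃ w, E v w) {L L' : V → Set AP} (hL : AgreeBelow lev n L L') (x : V) :
    Constraints B R E h x L' ↔ Constraints B R E h x L := by
  refine and_congr ?_ ?_
  · refine forall₄_congr fun p hp v _ => ?_
    rw [hL p.1 (wf.key p hp) v, (wf.atomsB p hp).sat_iff h hL]
  · exact forall₂_congr fun r hr => (wf.atomsR r hr).sat_iff h hL x

theorem constraints_append {V : Type} {B B' : List (AP × NNF AP)} {R R' : List (NNF AP)}
    {E : V → V → Prop} {h : ∀ v, ∃ w, E v w} {x : V} {L : V → Set AP} :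
    Constraints (B ++ B') (R ++ R') E h x L ↔
      Constraints B R E h x L ∧ Constraints B' R' E h x L := by
  simp only [Constraints, List.forall_mem_append]
  tauto

theorem ConstraintsWF.mono {lev : AP → ℕ} {n m : ℕ} {B : List (AP × NNF AP)}
    {R : List (NNF AP)} (wf : ConstraintsWF lev n B R) (hm : n ≤ m) :
    ConstraintsWF lev m B R :=
  { wf with
    key := fun p hp => (wf.key p hp).trans_le hm
    atomsB := fun p hp => (wf.atomsB p hp).mono hm
    atomsR := fun r hr => (wf.atomsR r hr).mono hm }

theorem ConstraintsWF.append {lev : AP → ℕ} {n : ℕ} {B B' : List (AP × NNF AP)}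
    {R R' : List (NNF AP)} (wf : ConstraintsWF lev n B R) (wf' : ConstraintsWF lev n B' R') :
    ConstraintsWF lev n (B ++ B') (R ++ R') where
  key := List.forall_mem_append.2 ⟨wf.key, wf'.key⟩
  atomsB := List.forall_mem_append.2 ⟨wf.atomsB, wf'.atomsB⟩
  basic := List.forall_mem_append.2 ⟨wf.basic, wf'.basic⟩
  sizeB := List.forall_mem_append.2 ⟨wf.sizeB, wf'.sizeB⟩
  atomsR := List.forall_mem_append.2 ⟨wf.atomsR, wf'.atomsR⟩
  only := List.forall_mem_append.2 ⟨wf.only, wf'.only⟩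
  height := List.forall_mem_append.2 ⟨wf.height, wf'.height⟩
  sizeR := List.forall_mem_append.2 ⟨wf.sizeR, wf'.sizeR⟩

theorem ConstraintsWF.singleton {lev : AP → ℕ} {n : ℕ} {k : AP} {θ : NNF AP}
    (hk : lev k < n) (hθ : θ.AtomsBelow lev n) (hb : NNFBasic θ) (hs : θ.nsize ≤ 20) :
    ConstraintsWF lev n [(k, θ)] [] := by
  constructor <;> simp [*]

theorem constraints_singleton {V : Type} {k : AP} {θ : NNF AP} {E : V → V → Prop}
    {h : ∀ v, ∃ w, E v w} {x : V} {L : V → Set AP} :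
    Constraints [(k, θ)] [] E h x L ↔ ∀ v, Relation.ReflTransGen E x v → k ∈ L v →
      θ.toQCTL.sat ⟨E, h, L⟩ v := by
  simp [Constraints]

theorem represents_atom {lev : AP → ℕ} {n : ℕ} {c : AP} (hc : lev c < n) :
    Represents lev n n [] [] [] c fun _ _ _ L v => c ∈ L v where
  le := le_rfl
  low := by simp
  wf := by constructor <;> simp
  head := hc
  upper _ _ _ _ _ := ⟨⟨by simp, by simp⟩, fun _ _ hv => hv⟩
  lower _ _ _ _ _ := fun _ _ _ hv => hv

/-- A node whose value is a monotone function of its two children. -/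
theorem Represents.node {lev : AP → ℕ} {n n₁ n₂ : ℕ} {Q₁ Q₂ : List (Bool × AP)}
    {B₁ B₂ : List (AP × NNF AP)} {R₁ R₂ : List (NNF AP)} {c₁ c₂ : AP} {P₁ P₂ : StatePred AP}
    (h₁ : Represents lev n n₁ Q₁ B₁ R₁ c₁ P₁) (h₂ : Represents lev n₁ n₂ Q₂ B₂ R₂ c₂ P₂)
    (hP₂ : P₂.DependsBelow lev n)
    {κ : AP} (hκ : lev κ = n₂) {θ : NNF AP} (hθ : θ.AtomsBelow lev n₂) (hb : NNFBasic θ)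
    (hs : θ.nsize ≤ 20)
    (F : ∀ V : Type, (V → V → Prop) → (V → Set AP) → (V → Prop) → (V → Prop) → V → Prop)
    (hF : ∀ (V : Type) (E : V → V → Prop) (L : V → Set AP) (A A' B B' : V → Prop) (x : V),
      (∀ v, Relation.ReflTransGen E x v → A v → A' v) →
      (∀ v, Relation.ReflTransGen E x v → B v → B' v) → F V E L A B x → F V E L A' B' x)
    (hFc : ∀ (V : Type) (E : V → V → Prop) (L L' : V → Set AP) (A B : V → Prop) (x : V),
      AgreeBelow lev n L L' → (F V E L' A B x ↔ F V E L A B x))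
    (hFθ : ∀ (V : Type) (E : V → V → Prop) (h : ∀ v, ∃ w, E v w) (L : V → Set AP) (v : V),
      θ.toQCTL.sat ⟨E, h, L⟩ v ↔ F V E L (fun u => c₁ ∈ L u) (fun u => c₂ ∈ L u) v) :
    Represents lev n (n₂ + 1) (Q₁ ++ (Q₂ ++ [(true, κ)])) (B₁ ++ (B₂ ++ [(κ, θ)]))
      (R₁ ++ (R₂ ++ [])) κ
      fun V E h L v => F V E L (P₁ V E h L) (P₂ V E h L) v where
  le := (h₁.le.trans h₂.le).trans (Nat.le_succ _)
  low := by
    have := h₁.le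
    have := h₂.le
    simp only [List.forall_mem_append, List.forall_mem_singleton]
    exact ⟨h₁.low, fun q hq => h₁.le.trans (h₂.low q hq), by omega⟩
  wf := by
    have := h₂.le
    exact (h₁.wf.mono (by omega)).append ((h₂.wf.mono (by omega)).append
      (.singleton (by omega) (hθ.mono (by omega)) hb hs))
  head := by omega
  upper V E h L x := by
    have hn₁ := h₁.le
    have hn₂ := h₂.le
    rw [play_append]
    refine play_mono h₁.low (h₁.upper V E h L x) fun L₁ hL₁ ⟨hC₁, hc₁⟩ => ?_
    rw [play_append]
    refine play_mono h₂.low (h₂.upper V E h L₁ x) fun L₂ hL₂ ⟨hC₂, hc₂⟩ => ?_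
    refine ⟨{v | F V E L (P₁ V E h L) (P₂ V E h L) v}, ?_⟩
    have hL₃ := agreeBelow_setAtom hκ.ge L₂ {v | F V E L (P₁ V E h L) (P₂ V E h L) v}
    refine ⟨?_, fun v _ hv => by simpa using hv⟩
    rw [constraints_append, constraints_append, constraints_singleton,
      constraints_congr h₂.wf h hL₃, constraints_congr h₁.wf h (hL₂.trans (hL₃.mono hn₂))]
    refine ⟨hC₁, hC₂, fun v hv hκv => ?_⟩
    rw [mem_setAtom, if_pos rfl] at hκv
    rw [hFθ, hFc V E L _ _ _ v
      ((hL₁.trans (hL₂.mono hn₁)).trans (hL₃.mono (hn₁.trans hn₂)))]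
    refine hF V E L _ _ _ _ v (fun u hu hPu => ?_) (fun u hu hPu => ?_) hκv
    · exact ((hL₂.trans (hL₃.mono hn₂)) c₁ h₁.head u).2 (hc₁ u (hv.trans hu) hPu)
    · exact (hL₃ c₂ h₂.head u).2 (hc₂ u (hv.trans hu) ((hP₂ V E h L L₁ hL₁ u).2 hPu))
  lower V E h L x := by
    have hn₁ := h₁.le
    have hn₂ := h₂.le
    simp only [dualPrefix, List.map_append]
    rw [play_append]
    refine play_mono (le_of_mem_dualPrefix h₁.low) (h₁.lower V E h L x)
      fun L₁ hL₁ hC₁ => ?_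
    rw [play_append]
    refine play_mono (le_of_mem_dualPrefix h₂.low) (h₂.lower V E h L₁ x)
      fun L₂ hL₂ hC₂ => ?_
    intro s
    have hL₃ := agreeBelow_setAtom hκ.ge L₂ s
    change _ → _
    rw [constraints_append, constraints_append, constraints_singleton,
      constraints_congr h₂.wf h hL₃, constraints_congr h₁.wf h (hL₂.trans (hL₃.mono hn₂))]
    rintro ⟨hI₁, hI₂, hI₃⟩ v hv hκv
    have := hI₃ v hv hκv
    rw [hFθ, hFc V E L _ _ _ v
      ((hL₁.trans (hL₂.mono hn₁)).trans (hL₃.mono (hn₁.trans hn₂)))] at this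
    refine hF V E L _ _ _ _ v (fun u hu hcu => ?_) (fun u hu hcu => ?_) this
    · exact hC₁ hI₁ u (hv.trans hu) (((hL₂.trans (hL₃.mono hn₂)) c₁ h₁.head u).1 hcu)
    · exact (hP₂ V E h L L₁ hL₁ u).1 (hC₂ hI₂ u (hv.trans hu) ((hL₃ c₂ h₂.head u).1 hcu))

/-- A universally quantified node. -/
theorem Represents.forall_node {lev : AP → ℕ} {n n' : ℕ} {Q : List (Bool × AP)}
    {B : List (AP × NNF AP)} {R : List (NNF AP)} {c κ p : AP} {P P' : StatePred AP}
    (hκ : lev κ = n) (hp : lev p = n + 1)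
    (hr : Represents lev (n + 2) n' Q B R c P') (hP : P.DependsBelow lev n)
    (hPP' : ∀ (V : Type) (E : V → V → Prop) (h : ∀ v, ∃ w, E v w) (L : V → Set AP) (v : V),
      P V E h L v ↔ ∀ s : Set V, P' V E h (setAtom L p s) v) :
    Represents lev n n' ((true, κ) :: (false, p) :: Q)
      ([(κ, .nEU (.atom c) (.atom c))] ++ B) ([] ++ R) κ P where
  le := by have := hr.le; omega
  low := by
    simp only [List.forall_mem_cons]
    exact ⟨hκ.ge, by omega, fun q hq => by have := hr.low q hq; omega⟩
  wf := by
    have := hr.le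
    have hc := hr.head
    refine .append (.singleton (by omega) ?_ (.nEU (.atom c) (.atom c)) (by simp [NNF.nsize]))
      hr.wf
    simpa [NNF.AtomsBelow, NNF.toQCTL, atoms] using hc
  head := by have := hr.le; omega
  upper V E h L x := by
    refine ⟨{v | P V E h L v}, fun s => ?_⟩
    have hL₁ := agreeBelow_setAtom (n := n) hκ.ge L {v | P V E h L v}
    set L₁ := setAtom L κ {v | P V E h L v} with hL₁_def
    refine play_mono hr.low (hr.upper V E h (setAtom L₁ p s) x) fun L₂ hL₂ ⟨hC, hc⟩ => ?_
    have key : ∀ v, κ ∈ L₂ v ↔ P V E h L v := fun v => by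
      have : κ ≠ p := by rintro rfl; omega
      rw [hL₂ κ (by omega) v]
      simp [hL₁_def, this]
    refine ⟨?_, fun v _ hv => (key v).2 hv⟩
    rw [constraints_append, constraints_singleton]
    refine ⟨fun v hv hκv => ?_, hC⟩
    refine (existsUntil_self h (fun u => c ∈ L₂ u) v).2 (hc v hv ?_)
    exact (hPP' V E h L₁ v).1 ((hP V E h L L₁ hL₁ v).2 ((key v).1 hκv)) s
  lower V E h L x := by
    intro k
    have hL₁ := agreeBelow_setAtom (n := n) hκ.ge L k
    set L₁ := setAtom L κ k with hL₁_def
    have key : ∀ s L₂, AgreeBelow lev (n + 2) (setAtom L₁ p s) L₂ →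
        ∀ v, κ ∈ L₂ v ↔ v ∈ k := fun s L₂ hL₂ v => by
      have : κ ≠ p := by rintro rfl; omega
      rw [hL₂ κ (by omega) v]
      simp [hL₁_def, this]
    by_cases hk : ∀ v, Relation.ReflTransGen E x v → v ∈ k → P V E h L v
    · refine ⟨∅, play_mono (le_of_mem_dualPrefix hr.low)
        (play_of_forall _ _ fun _ => trivial) fun L₂ hL₂ _ _ v hv hκv => ?_⟩
      exact hk v hv ((key _ L₂ hL₂ v).1 hκv)
    · push Not at hk
      obtain ⟨w, hw, hwk, hPw⟩ := hk
      rw [← hP V E h L L₁ hL₁ w, hPP'] at hPw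
      push Not at hPw
      obtain ⟨s, hs⟩ := hPw
      refine ⟨s, play_mono (le_of_mem_dualPrefix hr.low)
        (hr.lower V E h (setAtom L₁ p s) x) fun L₂ hL₂ hC hI => ?_⟩
      rw [constraints_append, constraints_singleton] at hI
      refine absurd (hC hI.2 w hw ?_) hs
      exact (existsUntil_self h (fun u => c ∈ L₂ u) w).1
        (hI.1 w hw ((key s L₂ hL₂ w).2 hwk))

/-- The formula `E ⊤ U (z ∧ β)`, with `⊤` spelled `z ∨ ¬z`. -/
def reachFormula (z : AP) (β : NNF AP) : NNF AP :=
  .nEU (.nor (.atom z) (.natom z)) (.nand (.atom z) β)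

theorem sat_reachFormula_iff {V : Type} (z : AP) (β : NNF AP) (E : V → V → Prop)
    (h : ∀ v, ∃ w, E v w) (L : V → Set AP) (v : V) :
    (reachFormula z β).toQCTL.sat ⟨E, h, L⟩ v ↔
      ∃ u, Relation.ReflTransGen E v u ∧ z ∈ L u ∧ β.toQCTL.sat ⟨E, h, L⟩ u := by
  simp only [reachFormula, NNF.toQCTL, sat_qEU_iff]
  rw [existsUntil_of_forall h (fun u => by simp only [sat]; tauto)]
  simp only [sat_qand_iff]
  rfl

/-- Either both `e₁` and `e₂` hold now, or `c` always holds when `κ` and `z` do. -/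
def guardFormula (e₁ e₂ κ z c : AP) : NNF AP :=
  .nor (.nand (.atom e₁) (.atom e₂)) (.nAG (.nor (.natom κ) (.nor (.natom z) (.atom c))))

theorem sat_guardFormula_iff {V : Type} (e₁ e₂ κ z c : AP) (E : V → V → Prop)
    (h : ∀ v, ∃ w, E v w) (L : V → Set AP) (x : V) :
    (guardFormula e₁ e₂ κ z c).toQCTL.sat ⟨E, h, L⟩ x ↔
      (e₁ ∈ L x ∧ e₂ ∈ L x) ∨
        ∀ v, Relation.ReflTransGen E x v → κ ∈ L v → z ∈ L v → c ∈ L v := by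
  have : ∀ φ ψ : QCTL AP, (qor φ ψ).sat ⟨E, h, L⟩ = fun v =>
    φ.sat ⟨E, h, L⟩ v ∨ ψ.sat ⟨E, h, L⟩ v := fun _ _ => rfl
  simp only [guardFormula, NNF.toQCTL, this, sat_qAG_iff, sat_qand_iff, sat_qneg_iff]
  simp only [sat, imp_iff_not_or]

/-- An existentially quantified node. -/
theorem Represents.exists_node {lev : AP → ℕ} {n n' : ℕ} {Q : List (Bool × AP)}
    {B : List (AP × NNF AP)} {R : List (NNF AP)} {c κ z y e₁ e₂ p : AP} {P P' : StatePred AP}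
    (hκ : lev κ = n) (hz : lev z = n + 1) (hy : lev y = n + 2) (he₁ : lev e₁ = n + 3)
    (he₂ : lev e₂ = n + 4) (hp : lev p = n + 5) (hdef : lev (default : AP) < n)
    (hr : Represents lev (n + 6) n' Q B R c P') (hP : P.DependsBelow lev n)
    (hPP' : ∀ (V : Type) (E : V → V → Prop) (h : ∀ v, ∃ w, E v w) (L : V → Set AP) (v : V),
      P V E h L v ↔ ∃ s : Set V, P' V E h (setAtom L p s) v) :
    Represents lev n n'
      ((true, κ) :: (false, z) :: (true, y) :: (true, e₁) :: (true, e₂) :: (true, p) :: Q)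
      ([(e₁, reachFormula z (.atom y))] ++ ([(e₂, reachFormula z (.natom y))] ++ B))
      ([] ++ ([] ++ (guardFormula e₁ e₂ κ z c :: R))) κ P := by
  have hne : κ ≠ z ∧ κ ≠ y ∧ κ ≠ e₁ ∧ κ ≠ e₂ ∧ κ ≠ p ∧ z ≠ y ∧ z ≠ e₁ ∧ z ≠ e₂ ∧ z ≠ p ∧
      y ≠ e₁ ∧ y ≠ e₂ ∧ y ≠ p ∧ e₁ ≠ e₂ ∧ e₁ ≠ p ∧ e₂ ≠ p := by
    refine ⟨?_, ?_, ?_, ?_, ?_, ?_, ?_, ?_, ?_, ?_, ?_, ?_, ?_, ?_, ?_⟩ <;>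
      (rintro rfl; omega)
  obtain ⟨hκz, hκy, hκ₁, hκ₂, hκp, hzy, hz₁, hz₂, hzp, hy₁, hy₂, hyp, h₁₂, h₁p, h₂p⟩ := hne
  have hagree : ∀ {V : Type} (L : V → Set AP) (k Z Y s₁ s₂ : Set V), AgreeBelow lev n L
      (setAtom (setAtom (setAtom (setAtom (setAtom L κ k) z Z) y Y) e₁ s₁) e₂ s₂) := by
    intro V L k Z Y s₁ s₂
    exact ((((agreeBelow_setAtom (by omega) _ _).trans (agreeBelow_setAtom (by omega) _ _)).trans
      (agreeBelow_setAtom (by omega) _ _)).trans (agreeBelow_setAtom (by omega) _ _)).trans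
      (agreeBelow_setAtom (by omega) _ _)
  have hmem : ∀ {V : Type} (L L' : V → Set AP) (k Z Y s₁ s₂ s : Set V),
      AgreeBelow lev (n + 6) (setAtom (setAtom (setAtom (setAtom (setAtom (setAtom L κ k) z Z)
        y Y) e₁ s₁) e₂ s₂) p s) L' → ∀ v, (κ ∈ L' v ↔ v ∈ k) ∧ (z ∈ L' v ↔ v ∈ Z) ∧
        (y ∈ L' v ↔ v ∈ Y) ∧ (e₁ ∈ L' v ↔ v ∈ s₁) ∧ (e₂ ∈ L' v ↔ v ∈ s₂) := by
    intro V L L' k Z Y s₁ s₂ s hL v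
    rw [hL κ (by omega), hL z (by omega), hL y (by omega), hL e₁ (by omega), hL e₂ (by omega)]
    simp [hκz, hκy, hκ₁, hκ₂, hκp, hzy, hz₁, hz₂, hzp, hy₁, hy₂, hyp, h₁₂, h₁p, h₂p]
  have hconstr : ∀ {V : Type} (E : V → V → Prop) (h : ∀ v, ∃ w, E v w) (x : V)
      (L : V → Set AP), Constraints
        ([(e₁, reachFormula z (.atom y))] ++ ([(e₂, reachFormula z (.natom y))] ++ B))
        ([] ++ ([] ++ (guardFormula e₁ e₂ κ z c :: R))) E h x L ↔
      (∀ v, Relation.ReflTransGen E x v → e₁ ∈ L v →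
        ∃ u, Relation.ReflTransGen E v u ∧ z ∈ L u ∧ y ∈ L u) ∧
      (∀ v, Relation.ReflTransGen E x v → e₂ ∈ L v →
        ∃ u, Relation.ReflTransGen E v u ∧ z ∈ L u ∧ y ∉ L u) ∧
      ((e₁ ∈ L x ∧ e₂ ∈ L x) ∨
        ∀ v, Relation.ReflTransGen E x v → κ ∈ L v → z ∈ L v → c ∈ L v) ∧
      Constraints B R E h x L := by
    intro V E h x L
    rw [constraints_append, constraints_append, constraints_singleton, constraints_singleton,
      ← sat_guardFormula_iff e₁ e₂ κ z c E h]
    simp only [sat_reachFormula_iff, NNF.toQCTL, sat_qneg_iff, Constraints,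
      List.forall_mem_cons, sat]
    tauto
  have hle := hr.le
  have hhead := hr.head
  refine ⟨by omega, ?_, ?_, by omega, fun V E h L x => ?_, fun V E h L x => ?_⟩
  · simp only [List.forall_mem_cons]
    exact ⟨by omega, by omega, by omega, by omega, by omega, by omega,
      fun q hq => by have := hr.low q hq; omega⟩
  · have hR : ConstraintsWF lev n' [] [guardFormula e₁ e₂ κ z c] := by
      constructor <;>
        simp [guardFormula, NNF.AtomsBelow, NNF.toQCTL, atoms, qand, qAG, qEF, qtop,
          NNF.nht, NNF.nsize]
      · omega
      · exact .nor (.nand (.atom _) (.atom _))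
          (.nAG (.nor (.natom _) (.nor (.natom _) (.atom _))))
    have hB₁ : ConstraintsWF lev n' [(e₁, reachFormula z (.atom y))] [] := by
      refine .singleton (by omega) ?_ (.nEU (.nor (.atom _) (.natom _))
        (.nand (.atom _) (.atom _))) (by simp [reachFormula, NNF.nsize])
      simp [reachFormula, NNF.AtomsBelow, NNF.toQCTL, atoms, qand]
      omega
    have hB₂ : ConstraintsWF lev n' [(e₂, reachFormula z (.natom y))] [] := by
      refine .singleton (by omega) ?_ (.nEU (.nor (.atom _) (.natom _))
        (.nand (.atom _) (.natom _))) (by simp [reachFormula, NNF.nsize])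
      simp [reachFormula, NNF.AtomsBelow, NNF.toQCTL, atoms, qand]
      omega
    exact hB₁.append (hB₂.append (hR.append hr.wf))
  · refine ⟨{v | P V E h L v}, fun Z => ?_⟩
    obtain ⟨Y, hY⟩ : ∃ Y : Set V,
        ((∃ u, Relation.ReflTransGen E x u ∧ u ∈ Z ∧ u ∈ Y) ∧
          ∃ u, Relation.ReflTransGen E x u ∧ u ∈ Z ∧ u ∉ Y) ∨
        ∀ u w, Relation.ReflTransGen E x u → Relation.ReflTransGen E x w →
          u ∈ Z → w ∈ Z → u = w := by
      by_cases hu : ∀ u w, Relation.ReflTransGen E x u → Relation.ReflTransGen E x w →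
          u ∈ Z → w ∈ Z → u = w
      · exact ⟨∅, .inr hu⟩
      · push Not at hu
        obtain ⟨u, w, hxu, hxw, huZ, hwZ, huw⟩ := hu
        exact ⟨{u}, .inl ⟨⟨u, hxu, huZ, rfl⟩, ⟨w, hxw, hwZ, fun hwu => huw hwu.symm⟩⟩⟩
    refine ⟨Y, {v | ∃ u, Relation.ReflTransGen E v u ∧ u ∈ Z ∧ u ∈ Y},
      {v | ∃ u, Relation.ReflTransGen E v u ∧ u ∈ Z ∧ u ∉ Y}, ?_⟩
    have hL₁ := hagree L {v | P V E h L v} Z Y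
      {v | ∃ u, Relation.ReflTransGen E v u ∧ u ∈ Z ∧ u ∈ Y}
      {v | ∃ u, Relation.ReflTransGen E v u ∧ u ∈ Z ∧ u ∉ Y}
    have hmem' := fun L' => hmem L L' {v | P V E h L v} Z Y
      {v | ∃ u, Relation.ReflTransGen E v u ∧ u ∈ Z ∧ u ∈ Y}
      {v | ∃ u, Relation.ReflTransGen E v u ∧ u ∈ Z ∧ u ∉ Y}
    generalize setAtom (setAtom (setAtom (setAtom (setAtom L κ {v | P V E h L v}) z Z) y Y) e₁
      {v | ∃ u, Relation.ReflTransGen E v u ∧ u ∈ Z ∧ u ∈ Y}) e₂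
      {v | ∃ u, Relation.ReflTransGen E v u ∧ u ∈ Z ∧ u ∉ Y} = L₁ at hL₁ hmem'
    obtain ⟨s, hs⟩ : ∃ s : Set V,
        ((∃ u, Relation.ReflTransGen E x u ∧ u ∈ Z ∧ u ∈ Y) ∧
          ∃ u, Relation.ReflTransGen E x u ∧ u ∈ Z ∧ u ∉ Y) ∨
        ∀ u, Relation.ReflTransGen E x u → P V E h L u → u ∈ Z →
          P' V E h (setAtom L₁ p s) u := by
      rcases hY with hY | hY
      · exact ⟨∅, .inl hY⟩
      · by_cases hw : ∃ w, Relation.ReflTransGen E x w ∧ P V E h L w ∧ w ∈ Z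
        · obtain ⟨w, hxw, hPw, hwZ⟩ := hw
          obtain ⟨s, hs⟩ := (hPP' V E h L₁ w).1 ((hP V E h L L₁ hL₁ w).2 hPw)
          exact ⟨s, .inr fun u hxu _ huZ => hY w u hxw hxu hwZ huZ ▸ hs⟩
        · exact ⟨∅, .inr fun u hxu hPu huZ => absurd ⟨u, hxu, hPu, huZ⟩ hw⟩
    refine ⟨s, play_mono hr.low (hr.upper V E h (setAtom L₁ p s) x)
      fun L₂ hL₂ ⟨hC, hc⟩ => ?_⟩
    have key := hmem' L₂ s hL₂
    refine ⟨(hconstr E h x L₂).2 ⟨fun v _ hv => ?_, fun v _ hv => ?_, ?_, hC⟩,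
      fun v _ hv => (key v).1.2 hv⟩
    · obtain ⟨u, hvu, hu⟩ := (key v).2.2.2.1.1 hv
      exact ⟨u, hvu, (key u).2.1.2 hu.1, (key u).2.2.1.2 hu.2⟩
    · obtain ⟨u, hvu, hu⟩ := (key v).2.2.2.2.1 hv
      exact ⟨u, hvu, (key u).2.1.2 hu.1, fun hy => hu.2 ((key u).2.2.1.1 hy)⟩
    · rcases hs with hs | hs
      · exact .inl ⟨(key x).2.2.2.1.2 hs.1, (key x).2.2.2.2.2 hs.2⟩
      · exact .inr fun v hv hκv hzv => hc v hv (hs v hv ((key v).1.1 hκv) ((key v).2.1.1 hzv))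
  · intro k
    by_cases hk : ∀ v, Relation.ReflTransGen E x v → v ∈ k → P V E h L v
    · refine ⟨∅, fun Y s₁ s₂ s => play_mono (le_of_mem_dualPrefix hr.low)
        (play_of_forall _ _ fun _ => trivial) fun L₂ hL₂ _ _ v hv hκv => ?_⟩
      exact hk v hv ((hmem L L₂ k _ Y s₁ s₂ s hL₂ v).1.1 hκv)
    · push Not at hk
      obtain ⟨w, hw, hwk, hPw⟩ := hk
      refine ⟨{w}, fun Y s₁ s₂ s => play_mono (le_of_mem_dualPrefix hr.low)
        (hr.lower V E h _ x) fun L₂ hL₂ hC hI => ?_⟩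
      have key := hmem L L₂ k {w} Y s₁ s₂ s hL₂
      obtain ⟨hI₁, hI₂, hI₃, hI⟩ := (hconstr E h x L₂).1 hI
      exfalso
      rcases hI₃ with ⟨hx₁, hx₂⟩ | hI₃
      · obtain ⟨u, -, huz, huy⟩ := hI₁ x .refl hx₁
        obtain ⟨u', -, huz', huy'⟩ := hI₂ x .refl hx₂
        obtain rfl : u = w := (key u).2.1.1 huz
        obtain rfl : u' = u := (key u').2.1.1 huz'
        exact huy' huy
      · refine hPw ((hP V E h L _ (hagree L k {w} Y s₁ s₂) w).1 ((hPP' V E h _ w).2 ⟨s, ?_⟩))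
        exact hC hI w hw (hI₃ w hw ((key w).1.2 hwk) ((key w).2.1.2 rfl))

theorem Represents.congr {lev : AP → ℕ} {n n' : ℕ} {Q : List (Bool × AP)}
    {B : List (AP × NNF AP)} {R : List (NNF AP)} {c : AP} {P P' : StatePred AP}
    (hr : Represents lev n n' Q B R c P)
    (hPP' : ∀ V E h (L : V → Set AP) v, P' V E h L v ↔ P V E h L v) :
    Represents lev n n' Q B R c P' := by
  obtain rfl : P' = P := by
    funext V E h L v
    exact propext (hPP' V E h L v)
  exact hr

/-- `P` is represented with fresh atoms of levels from `n` on, in size linear in `k`. -/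
def Representable (lev : AP → ℕ) (n : ℕ) (P : StatePred AP) (k : ℕ) : Prop :=
  ∃ n' Q B R c, Represents lev n n' Q B R c P ∧
    Q.length ≤ 6 * k ∧ B.length ≤ 2 * k ∧ R.length ≤ k

theorem representable_atom {lev : AP → ℕ} {n : ℕ} {c : AP} (hc : lev c < n) (k : ℕ) :
    Representable lev n (fun _ _ _ L v => c ∈ L v) k :=
  ⟨n, [], [], [], c, represents_atom hc, by simp, by simp, by simp⟩

theorem representable_node {lev : AP → ℕ} {g : ℕ → AP} (hg : ∀ i, lev (g i) = i)
    {n k₁ k₂ : ℕ} {P P₁ P₂ : StatePred AP} (h₁ : Representable lev n P₁ k₁)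
    (h₂ : ∀ m, n ≤ m → Representable lev m P₂ k₂) (hP₂ : P₂.DependsBelow lev n)
    (F : ∀ V : Type, (V → V → Prop) → (V → Set AP) → (V → Prop) → (V → Prop) → V → Prop)
    (hP : ∀ V E h (L : V → Set AP) v,
      P V E h L v ↔ F V E L (P₁ V E h L) (P₂ V E h L) v)
    (hF : ∀ (V : Type) (E : V → V → Prop) (L : V → Set AP) (A A' B B' : V → Prop) (x : V),
      (∀ v, Relation.ReflTransGen E x v → A v → A' v) →
      (∀ v, Relation.ReflTransGen E x v → B v → B' v) → F V E L A B x → F V E L A' B' x)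
    (hFc : ∀ (V : Type) (E : V → V → Prop) (L L' : V → Set AP) (A B : V → Prop) (x : V),
      AgreeBelow lev n L L' → (F V E L' A B x ↔ F V E L A B x))
    (θ : AP → AP → NNF AP)
    (hθ : ∀ m c₁ c₂, n ≤ m → lev c₁ < m → lev c₂ < m → (θ c₁ c₂).AtomsBelow lev m)
    (hb : ∀ c₁ c₂, NNFBasic (θ c₁ c₂)) (hs : ∀ c₁ c₂, (θ c₁ c₂).nsize ≤ 20)
    (hFθ : ∀ c₁ c₂ (V : Type) (E : V → V → Prop) (h : ∀ v, ∃ w, E v w) (L : V → Set AP)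
      (v : V), (θ c₁ c₂).toQCTL.sat ⟨E, h, L⟩ v ↔
        F V E L (fun u => c₁ ∈ L u) (fun u => c₂ ∈ L u) v) :
    Representable lev n P (k₁ + k₂ + 1) := by
  obtain ⟨n₁, Q₁, B₁, R₁, c₁, hr₁, hQ₁, hB₁, hR₁⟩ := h₁
  obtain ⟨n₂, Q₂, B₂, R₂, c₂, hr₂, hQ₂, hB₂, hR₂⟩ := h₂ n₁ hr₁.le
  have hle := hr₂.le
  refine ⟨_, _, _, _, _, (hr₁.node hr₂ hP₂ (hg n₂)
    (hθ n₂ c₁ c₂ (hr₁.le.trans hle) (hr₁.head.trans_le hle) hr₂.head) (hb c₁ c₂) (hs c₁ c₂)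
    F hF hFc (hFθ c₁ c₂)).congr hP, ?_, ?_, ?_⟩ <;>
  · simp only [List.length_append, List.length_singleton, List.length_nil]
    omega

/-- The truth value of `Φ`, negated if `b` is `false`, under the labelling pulled back
along the renaming `σ`. -/
def signedPred (b : Bool) (Φ : QCTL AP) (σ : AP → AP) : StatePred AP :=
  fun _ E h L v => Φ.sat ⟨E, h, fun u => {a | σ a ∈ L u}⟩ v ↔ b = true

omit [Inhabited AP] in
theorem signedPred_true (Φ : QCTL AP) (σ : AP → AP) {V : Type} (E : V → V → Prop)
    (h : ∀ v, ∃ w, E v w) (L : V → Set AP) :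
    signedPred true Φ σ V E h L = Φ.sat ⟨E, h, fun u => {a | σ a ∈ L u}⟩ := by
  funext v
  simp [signedPred]

omit [Inhabited AP] in
theorem signedPred_dependsBelow {lev : AP → ℕ} {n : ℕ} {σ : AP → AP}
    (hσ : ∀ a, lev (σ a) < n) (b : Bool) (Φ : QCTL AP) :
    (signedPred b Φ σ).DependsBelow lev n := by
  intro V E h L L' hL v
  have : (fun u => {a | σ a ∈ L' u}) = fun u => {a | σ a ∈ L u} := by
    funext u
    ext a
    exact hL (σ a) (hσ a) u
  rw [signedPred, signedPred, this]

omit [Inhabited AP] in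
theorem pullback_setAtom {V : Type} {σ : AP → AP} {p q : AP} (hq : ∀ a, σ a ≠ q)
    (L : V → Set AP) (s : Set V) :
    (fun u => {a | Function.update σ p q a ∈ setAtom L q s u}) =
      setAtom (fun u => {a | σ a ∈ L u}) p s := by
  funext u
  ext a
  by_cases ha : a = p
  · subst ha
    simp
  · simp [ha, hq a]

theorem representable_signedPred {lev : AP → ℕ} {g : ℕ → AP} (hg : ∀ i, lev (g i) = i)
    (hdef : lev (default : AP) = 0) (Φ : QCTL AP) :
    ∀ (b : Bool) (σ : AP → AP) (n : ℕ), 0 < n → (∀ a, lev (σ a) < n) →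
      Representable lev n (signedPred b Φ σ) Φ.qsize := by
  induction Φ with
  | atom p =>
    rintro (_ | _) σ n - hσ
    · refine representable_node hg (representable_atom (hσ p) 0)
        (fun m hm => representable_atom ((hσ p).trans_le hm) 0)
        (fun V E h L L' hL v => hL _ (hσ p) v) (fun V E L A B v => σ p ∉ L v)
        (fun V E h L v => ?_) (fun V E L A A' B B' x _ _ h => h)
        (fun V E L L' A B x hL => not_congr (hL _ (hσ p) x))
        (fun _ _ => .nEU (.natom (σ p)) (.natom (σ p))) (fun m c₁ c₂ hm _ _ => ?_)
        (fun _ _ => .nEU (.natom _) (.natom _)) (fun _ _ => by simp [NNF.nsize])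
        (fun c₁ c₂ V E h L v => existsUntil_self h (fun u => σ p ∉ L u) v)
      · simp [signedPred, sat]
      · simpa [NNF.AtomsBelow, NNF.toQCTL, atoms] using (hσ p).trans_le hm
    · obtain ⟨n', Q, B, R, c, hr, hb⟩ := representable_atom (hσ p) (QCTL.atom p).qsize
      exact ⟨n', Q, B, R, c, hr.congr fun V E h L v => by simp [signedPred, sat], hb⟩
  | qneg φ ih =>
    intro b σ n hn hσ
    obtain ⟨n', Q, B, R, c, hr, hQ, hB, hR⟩ := ih (!b) σ n hn hσ
    refine ⟨n', Q, B, R, c, hr.congr fun V E h L v => ?_, ?_, ?_, ?_⟩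
    · cases b <;> simp [signedPred, sat]
    all_goals
      simp only [qsize]
      omega
  | qor φ ψ ih₁ ih₂ =>
    rintro (_ | _) σ n hn hσ
    · refine representable_node hg (ih₁ false σ n hn hσ)
        (fun m hm => ih₂ false σ m (hn.trans_le hm) fun a => (hσ a).trans_le hm)
        (signedPred_dependsBelow hσ _ _) (fun V E L A B v => A v ∧ B v)
        (fun V E h L v => ?_) (fun V E L A A' B B' x hA hB h => ⟨hA x .refl h.1, hB x .refl h.2⟩)
        (fun V E L L' A B x hL => Iff.rfl)
        (fun c₁ c₂ => .nEU (.nand (.atom c₁) (.atom c₂)) (.nand (.atom c₁) (.atom c₂)))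
        (fun m c₁ c₂ hm h₁ h₂ => ?_)
        (fun _ _ => .nEU (.nand (.atom _) (.atom _)) (.nand (.atom _) (.atom _)))
        (fun _ _ => by simp [NNF.nsize]) (fun c₁ c₂ V E h L v => ?_)
      · simp [signedPred, sat]
      · simp [NNF.AtomsBelow, NNF.toQCTL, atoms, qand, h₁, h₂]
      · rw [NNF.toQCTL, sat_qEU_iff, existsUntil_self h, NNF.toQCTL, sat_qand_iff]
        rfl
    · refine representable_node hg (ih₁ true σ n hn hσ)
        (fun m hm => ih₂ true σ m (hn.trans_le hm) fun a => (hσ a).trans_le hm)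
        (signedPred_dependsBelow hσ _ _) (fun V E L A B v => A v ∨ B v)
        (fun V E h L v => ?_) (fun V E L A A' B B' x hA hB h => h.imp (hA x .refl) (hB x .refl))
        (fun V E L L' A B x hL => Iff.rfl)
        (fun c₁ c₂ => .nEU (.nor (.atom c₁) (.atom c₂)) (.nor (.atom c₁) (.atom c₂)))
        (fun m c₁ c₂ hm h₁ h₂ => ?_)
        (fun _ _ => .nEU (.nor (.atom _) (.atom _)) (.nor (.atom _) (.atom _)))
        (fun _ _ => by simp [NNF.nsize]) (fun c₁ c₂ V E h L v => ?_)
      · simp [signedPred, sat]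
      · simp [NNF.AtomsBelow, NNF.toQCTL, atoms, h₁, h₂]
      · rw [NNF.toQCTL, sat_qEU_iff, existsUntil_self h]
        rfl
  | qEX φ ih =>
    rintro (_ | _) σ n hn hσ
    · refine representable_node hg (ih false σ n hn hσ)
        (fun m hm => representable_atom ((hσ default).trans_le hm) 0)
        (fun V E h L L' hL v => hL _ (hσ default) v) (fun V E L A B v => ∀ y, E v y → A y)
        (fun V E h L v => ?_) (fun V E L A A' B B' x hA _ h y hy => hA y (.single hy) (h y hy))
        (fun V E L L' A B x hL => Iff.rfl)
        (fun c _ => .nAX (.atom c)) (fun m c₁ c₂ hm h₁ h₂ => ?_)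
        (fun _ _ => .nAX (.atom _)) (fun _ _ => by simp [NNF.nsize])
        (fun c₁ c₂ V E h L v => ?_)
      · simp [signedPred, sat]
      · simpa [NNF.AtomsBelow, NNF.toQCTL, atoms, qAX] using h₁
      · simp [NNF.toQCTL, sat, qAX]
    · refine representable_node hg (ih true σ n hn hσ)
        (fun m hm => representable_atom ((hσ default).trans_le hm) 0)
        (fun V E h L L' hL v => hL _ (hσ default) v) (fun V E L A B v => ∃ y, E v y ∧ A y)
        (fun V E h L v => ?_)
        (fun V E L A A' B B' x hA _ ⟨y, hy, hAy⟩ => ⟨y, hy, hA y (.single hy) hAy⟩)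
        (fun V E L L' A B x hL => Iff.rfl)
        (fun c _ => .nEX (.atom c)) (fun m c₁ c₂ hm h₁ h₂ => ?_)
        (fun _ _ => .nEX (.atom _)) (fun _ _ => by simp [NNF.nsize])
        (fun c₁ c₂ V E h L v => Iff.rfl)
      · simp [signedPred, sat]
      · simpa [NNF.AtomsBelow, NNF.toQCTL, atoms] using h₁
  | qEU φ ψ ih₁ ih₂ =>
    rintro (_ | _) σ n hn hσ
    · refine representable_node hg (ih₁ false σ n hn hσ)
        (fun m hm => ih₂ false σ m (hn.trans_le hm) fun a => (hσ a).trans_le hm)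
        (signedPred_dependsBelow hσ _ _)
        (fun V E L A B v => ¬ExistsUntil E (fun u => ¬A u) (fun u => ¬B u) v)
        (fun V E h L v => ?_)
        (fun V E L A A' B B' x hA hB => mt (existsUntil_mono (fun v hv => mt (hA v hv))
          fun v hv => mt (hB v hv)))
        (fun V E L L' A B x hL => Iff.rfl)
        (fun c₁ c₂ => .nAW (.atom c₂) (.nand (.atom c₁) (.atom c₂)))
        (fun m c₁ c₂ hm h₁ h₂ => ?_)
        (fun _ _ => .nAW (.atom _) (.nand (.atom _) (.atom _)))
        (fun _ _ => by simp [NNF.nsize]) (fun c₁ c₂ V E h L v => ?_)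
      · simp [signedPred, sat_qEU_iff]
      · simp [NNF.AtomsBelow, NNF.toQCTL, atoms, qand, h₁, h₂]
      · simp only [NNF.toQCTL, sat_qneg_iff, sat_qEU_iff]
        refine not_congr (exists_congr fun ρ => and_congr_right fun _ => and_congr_right fun _ => ?_)
        rw [← pathUntil_not_iff]
        simp only [PathUntil, sat_qand_iff, sat]
    · refine representable_node hg (ih₁ true σ n hn hσ)
        (fun m hm => ih₂ true σ m (hn.trans_le hm) fun a => (hσ a).trans_le hm)
        (signedPred_dependsBelow hσ _ _) (fun V E L A B v => ExistsUntil E A B v)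
        (fun V E h L v => ?_) (fun V E L A A' B B' x hA hB => existsUntil_mono hA hB)
        (fun V E L L' A B x hL => Iff.rfl)
        (fun c₁ c₂ => .nEU (.atom c₁) (.atom c₂)) (fun m c₁ c₂ hm h₁ h₂ => ?_)
        (fun _ _ => .nEU (.atom _) (.atom _))
        (fun _ _ => by simp [NNF.nsize]) (fun c₁ c₂ V E h L v => Iff.rfl)
      · simp only [signedPred_true, sat_qEU_iff]
      · simp [NNF.AtomsBelow, NNF.toQCTL, atoms, h₁, h₂]
  | qAU φ ψ ih₁ ih₂ =>
    rintro (_ | _) σ n hn hσ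
    · refine representable_node hg (ih₁ false σ n hn hσ)
        (fun m hm => ih₂ false σ m (hn.trans_le hm) fun a => (hσ a).trans_le hm)
        (signedPred_dependsBelow hσ _ _)
        (fun V E L A B v => ¬ForallUntil E (fun u => ¬A u) (fun u => ¬B u) v)
        (fun V E h L v => ?_)
        (fun V E L A A' B B' x hA hB => mt (forallUntil_mono (fun v hv => mt (hA v hv))
          fun v hv => mt (hB v hv)))
        (fun V E L L' A B x hL => Iff.rfl)
        (fun c₁ c₂ => .nEW (.atom c₂) (.nand (.atom c₁) (.atom c₂)))
        (fun m c₁ c₂ hm h₁ h₂ => ?_)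
        (fun _ _ => .nEW (.atom _) (.nand (.atom _) (.atom _)))
        (fun _ _ => by simp [NNF.nsize]) (fun c₁ c₂ V E h L v => ?_)
      · simp [signedPred, sat_qAU_iff]
      · simp [NNF.AtomsBelow, NNF.toQCTL, atoms, qand, h₁, h₂]
      · simp only [NNF.toQCTL, sat_qneg_iff, sat_qAU_iff]
        refine not_congr (forall₃_congr fun ρ _ _ => ?_)
        rw [← pathUntil_not_iff]
        simp only [PathUntil, sat_qand_iff, sat]
    · refine representable_node hg (ih₁ true σ n hn hσ)
        (fun m hm => ih₂ true σ m (hn.trans_le hm) fun a => (hσ a).trans_le hm)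
        (signedPred_dependsBelow hσ _ _) (fun V E L A B v => ForallUntil E A B v)
        (fun V E h L v => ?_) (fun V E L A A' B B' x hA hB => forallUntil_mono hA hB)
        (fun V E L L' A B x hL => Iff.rfl)
        (fun c₁ c₂ => .nAU (.atom c₁) (.atom c₂)) (fun m c₁ c₂ hm h₁ h₂ => ?_)
        (fun _ _ => .nAU (.atom _) (.atom _))
        (fun _ _ => by simp [NNF.nsize]) (fun c₁ c₂ V E h L v => Iff.rfl)
      · simp only [signedPred_true, sat_qAU_iff]
      · simp [NNF.AtomsBelow, NNF.toQCTL, atoms, h₁, h₂]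
  | qexi p φ ih =>
    have hfresh : ∀ {σ : AP → AP} {n i : ℕ}, (∀ a, lev (σ a) < n) → n ≤ i →
        ∀ a, σ a ≠ g i := fun hσ hi a ha => by
      have := hσ a
      rw [ha, hg] at this
      omega
    have hupdate : ∀ {σ : AP → AP} {n i : ℕ}, (∀ a, lev (σ a) < n) → n ≤ i →
        ∀ a, lev (Function.update σ p (g i) a) < i + 1 := fun {σ n i} hσ hi a => by
      have := hσ a
      by_cases ha : a = p
      · simp [ha, hg]
      · simp only [ne_eq, ha, not_false_eq_true, Function.update_of_ne]
        omega
    rintro (_ | _) σ n hn hσ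
    · obtain ⟨n', Q, B, R, c, hr, hQ, hB, hR⟩ := ih false (Function.update σ p (g (n + 1)))
        (n + 2) (by omega) (hupdate hσ (by omega))
      refine ⟨_, _, _, _, _, hr.forall_node (hg n) (hg (n + 1))
        (signedPred_dependsBelow hσ false (qexi p φ)) fun V E h L v => ?_, ?_, ?_, ?_⟩
      · simp only [signedPred, sat_qexi_iff, pullback_setAtom (hfresh hσ (Nat.le_succ n))]
        simp
      all_goals
        simp only [List.length_append, List.length_cons, List.length_nil, qsize]
        omega
    · obtain ⟨n', Q, B, R, c, hr, hQ, hB, hR⟩ := ih true (Function.update σ p (g (n + 5)))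
        (n + 6) (by omega) (hupdate hσ (by omega))
      refine ⟨_, _, _, _, _, hr.exists_node (hg n) (hg (n + 1)) (hg (n + 2)) (hg (n + 3))
        (hg (n + 4)) (hg (n + 5)) (by omega)
        (signedPred_dependsBelow hσ true (qexi p φ)) fun V E h L v => ?_, ?_, ?_, ?_⟩
      · simp only [signedPred, sat_qexi_iff, pullback_setAtom (hfresh hσ (Nat.le_add_right n 5)),
          iff_true]
      all_goals
        simp only [List.length_append, List.length_cons, List.length_nil, qsize]
        omega

theorem Represents.play_iff {lev : AP → ℕ} {n n' : ℕ} {Q : List (Bool × AP)}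
    {B : List (AP × NNF AP)} {R : List (NNF AP)} {c : AP} {P : StatePred AP}
    (hr : Represents lev n n' Q B R c P) {V : Type} (E : V → V → Prop)
    (h : ∀ v, ∃ w, E v w) (L : V → Set AP) (x : V) :
    (play Q L fun L' => Constraints B R E h x L' ∧ c ∈ L' x) ↔ P V E h L x := by
  constructor
  · intro hp
    obtain ⟨L', ⟨hC, hc⟩, hP⟩ := exists_of_play_dual hp (hr.lower V E h L x)
    exact hP hC x .refl hc
  · exact fun hP => play_mono hr.low (hr.upper V E h L x)
      fun L' _ hL' => ⟨hL'.1, hL'.2 x .refl hP⟩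

/-- The part `Φ₀` of the flat form. -/
def flatHead (B : List (AP × NNF AP)) (R : List (NNF AP)) (c : AP)
    (κ : Fin B.length → AP) : NNF AP :=
  (R ++ (List.finRange B.length).map fun i =>
    NNF.nAG (.nor (.natom (B.get i).1) (.atom (κ i)))).foldr .nand (.atom c)

theorem sat_nAG_imp_iff {V : Type} (k : AP) (θ : NNF AP) (E : V → V → Prop)
    (h : ∀ v, ∃ w, E v w) (L : V → Set AP) (x : V) :
    (NNF.nAG (.nor (.natom k) θ)).toQCTL.sat ⟨E, h, L⟩ x ↔
      ∀ v, Relation.ReflTransGen E x v → k ∈ L v → θ.toQCTL.sat ⟨E, h, L⟩ v := by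
  simp only [NNF.toQCTL, sat_qAG_iff, sat, ← imp_iff_not_or]

theorem sat_nnfFlatBody_iff {V : Type} (B : List (AP × NNF AP)) (R : List (NNF AP)) (c : AP)
    (κ : Fin B.length → AP) (E : V → V → Prop) (h : ∀ v, ∃ w, E v w) (L : V → Set AP) (x : V) :
    (nnfFlatBody B.length κ (flatHead B R c κ) fun i => (B.get i).2).toQCTL.sat ⟨E, h, L⟩ x ↔
      c ∈ L x ∧ (∀ r ∈ R, r.toQCTL.sat ⟨E, h, L⟩ x) ∧
      (∀ i, ∀ v, Relation.ReflTransGen E x v → (B.get i).1 ∈ L v → κ i ∈ L v) ∧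
      ∀ i, ∀ v, Relation.ReflTransGen E x v → κ i ∈ L v →
        (B.get i).2.toQCTL.sat ⟨E, h, L⟩ v := by
  simp only [nnfFlatBody, flatHead, sat_foldr_nand_iff, List.forall_mem_append,
    List.forall_mem_map, List.mem_finRange, true_imp_iff, sat_nAG_imp_iff, and_assoc]
  rfl

theorem play_flat_iff {lev : AP → ℕ} {n : ℕ} {B : List (AP × NNF AP)} {R : List (NNF AP)}
    (wf : ConstraintsWF lev n B R) {c : AP} (hc : lev c < n) {κ : Fin B.length → AP}
    (hκ : Function.Injective κ) (hκn : ∀ i, n ≤ lev (κ i)) {V : Type} (E : V → V → Prop)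
    (h : ∀ v, ∃ w, E v w) (L : V → Set AP) (x : V) :
    (play (((List.finRange B.length).map κ).map (Prod.mk true)) L fun L' =>
      (nnfFlatBody B.length κ (flatHead B R c κ) fun i => (B.get i).2).toQCTL.sat
        ⟨E, h, L'⟩ x) ↔ Constraints B R E h x L ∧ c ∈ L x := by
  have hagree : ∀ L' : V → Set AP,
      (∀ a ∉ (List.finRange B.length).map κ, ∀ v, a ∈ L' v ↔ a ∈ L v) →
      AgreeBelow lev n L L' := by
    refine fun L' hL a ha v => hL a (fun hmem => ?_) v
    obtain ⟨i, -, rfl⟩ := List.mem_map.1 hmem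
    have := hκn i
    omega
  simp only [play_exists_iff, sat_nnfFlatBody_iff]
  constructor
  · rintro ⟨L', hL, hcx, hR, h₁, h₂⟩
    have hL' := hagree L' hL
    refine ⟨(constraints_congr wf h hL' x).1 ⟨fun p hp v hv hpv => ?_, hR⟩, (hL' c hc x).1 hcx⟩
    obtain ⟨i, rfl⟩ := List.mem_iff_get.1 hp
    exact h₂ i v hv (h₁ i v hv hpv)
  · rintro ⟨hC, hcx⟩
    set L' : V → Set AP := fun v => {a | (∃ i, κ i = a ∧ (B.get i).1 ∈ L v) ∨
      (a ∉ (List.finRange B.length).map κ ∧ a ∈ L v)} with hL'_def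
    have hL : ∀ a ∉ (List.finRange B.length).map κ, ∀ v, a ∈ L' v ↔ a ∈ L v := by
      intro a ha v
      have : ¬∃ i, κ i = a ∧ (B.get i).1 ∈ L v := by
        rintro ⟨i, rfl, -⟩
        exact ha (List.mem_map.2 ⟨i, List.mem_finRange i, rfl⟩)
      simp only [hL'_def, Set.mem_ofPred_eq, this, false_or, ha, not_false_eq_true, true_and]
    have hL' := hagree L' hL
    have hmem : ∀ i v, κ i ∈ L' v ↔ (B.get i).1 ∈ L v := by
      intro i v
      have : κ i ∈ (List.finRange B.length).map κ :=
        List.mem_map.2 ⟨i, List.mem_finRange i, rfl⟩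
      simp only [hL'_def, Set.mem_ofPred_eq, this, not_true_eq_false, false_and, or_false]
      exact ⟨fun ⟨j, hj, hjv⟩ => hκ hj ▸ hjv, fun hi => ⟨i, rfl, hi⟩⟩
    have hC' := (constraints_congr wf h hL' x).2 hC
    have hkey : ∀ i v, (B.get i).1 ∈ L' v ↔ (B.get i).1 ∈ L v := fun i v =>
      hL' _ (wf.key _ (List.get_mem B i)) v
    exact ⟨L', hL, (hL' c hc x).2 hcx, hC'.2, fun i v _ hv => (hmem i v).2 ((hkey i v).1 hv),
      fun i v hv hκv => hC'.1 _ (List.get_mem B i) v hv ((hkey i v).2 ((hmem i v).1 hκv))⟩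

omit [Inhabited AP] in
theorem onlyEXAXAG_foldr_nand {φ : NNF AP} {l : List (NNF AP)} (hφ : NNFOnlyEXAXAG φ)
    (hl : ∀ ψ ∈ l, NNFOnlyEXAXAG ψ) : NNFOnlyEXAXAG (l.foldr .nand φ) := by
  induction l with
  | nil => exact hφ
  | cons ψ l ih =>
    exact .nand (hl ψ List.mem_cons_self) (ih fun χ hχ => hl χ (List.mem_cons_of_mem _ hχ))

omit [Inhabited AP] in
theorem nht_foldr_nand_le {φ : NNF AP} {l : List (NNF AP)} {k : ℕ} (hφ : φ.nht ≤ k)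
    (hl : ∀ ψ ∈ l, ψ.nht ≤ k) : (l.foldr NNF.nand φ).nht ≤ k := by
  induction l with
  | nil => exact hφ
  | cons ψ l ih =>
    exact max_le (hl ψ List.mem_cons_self) (ih fun χ hχ => hl χ (List.mem_cons_of_mem _ hχ))

omit [Inhabited AP] in
/-- Infinitely many atoms outside of a finite set, indexed by their level. -/
theorem exists_fresh_levels [Infinite AP] {A : Set AP} (hA : A.Finite) :
    ∃ (lev : AP → ℕ) (g : ℕ → AP), (∀ i, lev (g i) = i) ∧ ∀ a ∈ A, lev a = 0 := by
  obtain ⟨f⟩ : Nonempty (ℕ ↪ (Aᶜ : Set AP)) :=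
    have := hA.infinite_compl.to_subtype
    ⟨Infinite.natEmbedding _⟩
  have hf : Function.Injective fun i => (f i : AP) := Subtype.val_injective.comp f.injective
  refine ⟨fun a => if h : ∃ i, (f i : AP) = a then h.choose else 0, fun i => f i,
    fun i => ?_, fun a ha => ?_⟩
  · have hex : ∃ j, (f j : AP) = f i := ⟨i, rfl⟩
    simp only [dif_pos hex]
    exact hf hex.choose_spec
  · refine dif_neg ?_
    rintro ⟨i, rfl⟩
    exact (f i).2 ha

end Representation

/-- NNF flat form with implications: any QCTL formula `Φ` is equivalent to an NNF
formula `Ψ = Q ∃{κ₁,…,κₘ}.( Φ₀ ∧ ⋀ᵢ AG(κᵢ → θᵢ) )` where `Q` is a sequence of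
propositional quantifications, the `κᵢ` are fresh, `Φ₀` is a CTL formula containing
only the temporal modalities `EX`, `AX`, `AG` and of temporal height at most `1`,
every `θᵢ` is a basic CTL formula, and `|Ψ| ∈ O(|Φ|)`. -/
theorem nnf_flat_imp_exists {AP : Type} [Inhabited AP] [Infinite AP] :
    ∃ C : ℕ, ∀ Φ : QCTL AP,
      ∃ (Q : List (Bool × AP)) (m : ℕ) (κ : Fin m → AP)
        (Φ0 : NNF AP) (θ : Fin m → NNF AP),
        Function.Injective κ ∧ (∀ i, κ i ∉ Φ.atoms) ∧
        NNFOnlyEXAXAG Φ0 ∧ Φ0.nht ≤ 1 ∧ (∀ i, NNFBasic (θ i)) ∧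
        QEquiv Φ
          (NNF.prefixQ Q (NNF.exiMany ((List.finRange m).map κ)
            (nnfFlatBody m κ Φ0 θ))).toQCTL ∧
        (NNF.prefixQ Q (NNF.exiMany ((List.finRange m).map κ)
            (nnfFlatBody m κ Φ0 θ))).nsize ≤ C * Φ.qsize := by
  refine ⟨200, fun Φ => ?_⟩
  obtain ⟨lev, g, hg, hlev⟩ := exists_fresh_levels (Φ.atoms_finite.insert default)
  have hσ : ∀ a, lev (if lev a = 0 then a else g 0) < 1 := fun a => by
    split_ifs with ha <;> simp [ha, hg]
  obtain ⟨n, Q, B, R, c, hr, hQ, hB, hR⟩ := representable_signedPred hg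
    (hlev _ (Set.mem_insert _ _)) Φ true (fun a => if lev a = 0 then a else g 0) 1
    Nat.one_pos hσ
  have hle := hr.le
  have hκ : Function.Injective fun i : Fin B.length => g (n + i) := fun i j hij => by
    have := congrArg lev hij
    simp only [hg] at this
    exact Fin.ext (by omega)
  refine ⟨Q, B.length, fun i => g (n + i), flatHead B R c fun i => g (n + i),
    fun i => (B.get i).2, hκ, fun i hi => ?_, ?_, ?_,
    fun i => hr.wf.basic _ (List.get_mem B i), fun V _ K x => ?_, ?_⟩
  · have := hlev _ (Set.mem_insert_of_mem _ hi)
    rw [hg] at this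
    omega
  · refine onlyEXAXAG_foldr_nand (.atom c) (List.forall_mem_append.2 ⟨hr.wf.only, ?_⟩)
    exact List.forall_mem_map.2 fun _ _ => .nAG (.nor (.natom _) (.atom _))
  · refine nht_foldr_nand_le (Nat.zero_le 1) (List.forall_mem_append.2 ⟨hr.wf.height, ?_⟩)
    exact List.forall_mem_map.2 fun _ _ => by simp [NNF.nht]
  · obtain ⟨E, h, L⟩ := K
    rw [sat_prefixQ_iff]
    simp only [exiMany_eq_prefixQ, sat_prefixQ_iff]
    simp only [play_flat_iff hr.wf hr.head hκ (fun i => by simp [hg])]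
    rw [hr.play_iff, signedPred, iff_true_right rfl]
    refine QCTL.sat_congr E h Φ _ _ (fun a ha v => ?_) x
    simp [hlev a (Set.mem_insert_of_mem _ ha)]
  · rw [nsize_prefixQ, exiMany_eq_prefixQ, nsize_prefixQ]
    have h₁ : (flatHead B R c fun i => g (n + i)).nsize ≤ _ :=
      nsize_foldr_nand (k := 20) _ _ (List.forall_mem_append.2 ⟨hr.wf.sizeR,
        List.forall_mem_map.2 fun _ _ => by simp [NNF.nsize]⟩)
    have h₂ := nsize_foldr_nand (k := 25) (flatHead B R c fun i => g (n + i))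
      ((List.finRange B.length).map fun i : Fin B.length =>
        NNF.nAG (NNF.nor (NNF.natom (g (n + i))) (B.get i).2))
      (List.forall_mem_map.2 fun (i : Fin B.length) _ => by
        have := hr.wf.sizeB _ (List.get_mem B i)
        simp only [NNF.nsize]
        omega)
    have h₃ := Φ.qsize_pos
    simp only [List.length_append, List.length_map, List.length_finRange, NNF.nsize,
      nnfFlatBody] at h₁ h₂ ⊢
    omega
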